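/- Let A ∈ ℝ^{n×n} be symmetric with zero diagonal and Σ_j |A_{ij}| = δ > 0 for every i, let ψ_1,…,ψ_n satisfy (A.1)–(A.4), let π > 0, and let ε > 0 satisfy δε < 1. Then for every initial condition x_0 ∈ ℝ^n, the iterates of the map F(x) := (1 − εδ)x + επAψ(x) satisfy limsup_{k→∞} ‖F^k(x_0)‖_1 ≤ πn; i.e. the trajectories of the discrete-time system asymptotically converge to the set {x ∈ ℝ^n : ‖x‖_1 ≤ πn}. -/

import Mathlib

open Matrix Filter Set

/-- The eigenvalues of a real symmetric (Hermitian) matrix, sorted in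
nondecreasing order: `lambdaSorted M ⟨0,_⟩ = λ_1 ≤ … ≤ lambdaSorted M ⟨n-1,_⟩ = λ_n`.
Junk value `0` if `M` is not Hermitian. -/
noncomputable def lambdaSorted {n : ℕ} (M : Matrix (Fin n) (Fin n) ℝ) : Fin n → ℝ :=
  if hM : M.IsHermitian then hM.eigenvalues ∘ ⇑(Tuple.sort hM.eigenvalues) else 0

/-- The largest eigenvalue `λ_max = λ_n` of a real symmetric matrix. -/
noncomputable def lambdaMax {n : ℕ} (M : Matrix (Fin n) (Fin n) ℝ) : ℝ :=
  ⨆ i, lambdaSorted M i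

/-- The smallest eigenvalue `λ_min = λ_1` of a real symmetric matrix. -/
noncomputable def lambdaMin {n : ℕ} (M : Matrix (Fin n) (Fin n) ℝ) : ℝ :=
  ⨅ i, lambdaSorted M i

/-- Assumptions (A.1)–(A.4) on the nonlinearities `ψ_i`: continuously
differentiable, odd, monotone with unit slope at the origin, saturated at `±1`,
and sigmoidal (strictly convex for `x<0`, strictly concave for `x>0`). -/
structure IsSigmoid (ψ : ℝ → ℝ) : Prop where
  contDiff : ContDiff ℝ 1 ψ
  odd : ∀ y : ℝ, ψ (-y) = -ψ y
  deriv_pos : ∀ y : ℝ, 0 < deriv ψ y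
  deriv_zero : deriv ψ 0 = 1
  tendsto_atTop : Tendsto ψ atTop (nhds 1)
  tendsto_atBot : Tendsto ψ atBot (nhds (-1))
  strictConvexOn : StrictConvexOn ℝ (Iio (0:ℝ)) ψ
  strictConcaveOn : StrictConcaveOn ℝ (Ioi (0:ℝ)) ψ

/-- The value `±1` associated to a Boolean sign. -/
def signVal (b : Bool) : ℝ := if b then 1 else -1

/-- `max_{s ∈ {−1,1}^n} sᵀ H s`, which equals `n − 2ε(𝒢)` for the normalized
interaction matrix `H` of a signed graph with frustration index `ε(𝒢)`. -/
noncomputable def maxCut {n : ℕ} (H : Matrix (Fin n) (Fin n) ℝ) : ℝ :=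
  ⨆ s : Fin n → Bool, (fun i => signVal (s i)) ⬝ᵥ H.mulVec (fun i => signVal (s i))

/-- The sign function with `sgn 0 = 1`. -/
noncomputable def sgn (y : ℝ) : ℝ := if 0 ≤ y then 1 else -1

lemma IsSigmoid.abs_le_one {f : ℝ → ℝ} (h : IsSigmoid f) (y : ℝ) : |f y| ≤ 1 := by
  have hm : Monotone f := (strictMono_of_deriv_pos h.deriv_pos).monotone
  exact abs_le.2 ⟨hm.le_of_tendsto h.tendsto_atBot y, hm.ge_of_tendsto h.tendsto_atTop y⟩

/-- Corollary 1(ii): with `Δ = δI` and `δε < 1`, the iterates of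
`F(x) = (1 − εδ)x + επAψ(x)` satisfy `limsup_{k→∞} ‖F^k(x_0)‖₁ ≤ πn` for every
initial condition, i.e. trajectories converge to `{x : ‖x‖₁ ≤ πn}`. -/
theorem stmt_17 {n : ℕ} (hn : 2 ≤ n)
    (A : Matrix (Fin n) (Fin n) ℝ) (hA : A.IsSymm)
    (hdiag : ∀ i, A i i = 0)
    (δ : ℝ) (hδ : 0 < δ) (hrow : ∀ i, ∑ j, |A i j| = δ)
    (ψ : Fin n → ℝ → ℝ) (hψ : ∀ i, IsSigmoid (ψ i))
    (p : ℝ) (hp : 0 < p)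
    (ε : ℝ) (hε : 0 < ε) (hεδ : δ * ε < 1)
    (F : (Fin n → ℝ) → Fin n → ℝ)
    (hF : ∀ x, F x = (1 - ε * δ) • x + (ε * p) • A.mulVec (fun i => ψ i (x i))) :
    ∀ x0 : Fin n → ℝ,
      Filter.limsup (fun k : ℕ => ∑ i, |(F^[k] x0) i|) Filter.atTop ≤ p * n := by
  intro x0
  have hq0 : 0 ≤ 1 - ε * δ := by linarith [mul_comm δ ε]
  have hq1 : 1 - ε * δ < 1 := by linarith [mul_pos hε hδ]
  have hstep : ∀ x : Fin n → ℝ, ∑ i, |F x i| ≤ (1 - ε * δ) * ∑ i, |x i| + ε * δ * (p * n) := by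
    intro x
    have hi : ∀ i, |F x i| ≤ (1 - ε * δ) * |x i| + ε * p * δ := by
      intro i
      have hAi : |A.mulVec (fun i => ψ i (x i)) i| ≤ δ := by
        rw [← hrow i]
        simp only [Matrix.mulVec, dotProduct]
        refine (Finset.abs_sum_le_sum_abs _ _).trans (Finset.sum_le_sum fun j _ => ?_)
        rw [abs_mul]
        exact mul_le_of_le_one_right (abs_nonneg _) ((hψ j).abs_le_one _)
      rw [hF]
      simp only [Pi.add_apply, Pi.smul_apply, smul_eq_mul]
      refine (abs_add_le _ _).trans ?_
      rw [abs_mul, abs_mul, abs_of_nonneg hq0, abs_of_pos (mul_pos hε hp)]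
      have := mul_le_mul_of_nonneg_left hAi (mul_pos hε hp).le
      linarith
    refine (Finset.sum_le_sum fun i _ => hi i).trans (le_of_eq ?_)
    rw [Finset.sum_add_distrib, ← Finset.mul_sum]
    simp
    ring
  have hb : ∀ k : ℕ, ∑ i, |(F^[k] x0) i| ≤
      (1 - ε * δ) ^ k * (∑ i, |x0 i| - p * n) + p * n := by
    intro k
    induction k with
    | zero => simp
    | succ k ih =>
      rw [Function.iterate_succ_apply']
      refine (hstep _).trans ?_
      have := mul_le_mul_of_nonneg_left ih hq0
      rw [pow_succ]
      linarith
  have ht : Tendsto (fun k : ℕ => (1 - ε * δ) ^ k * (∑ i, |x0 i| - p * n) + p * n) atTop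
      (nhds (p * n)) := by
    have := ((tendsto_pow_atTop_nhds_zero_of_lt_one hq0 hq1).mul_const
      (∑ i, |x0 i| - p * n)).add_const (p * n)
    simpa using this
  rw [← ht.limsup_eq]
  refine limsup_le_limsup (Eventually.of_forall hb) ?_ ht.isBoundedUnder_le
  exact IsBoundedUnder.isCoboundedUnder_le
    (isBoundedUnder_of ⟨0, fun k => Finset.sum_nonneg fun i _ => abs_nonneg _⟩)
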